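/- arXiv:1804.04911 — 6 statements merged into one kernel-verified Lean document; each statement's English description precedes it below -/
import Mathlib

section
/- Let T>0, ε≥0, and 0<η⋆≤‖η‖. Let η:[0,T)→ℝ be measurable with η⋆≤η(u)≤‖η‖ for all u, and let A:[0,T)→[0,∞) be locally integrable with A(u)≥2η⋆/(T−u+ε) for almost every u∈[0,T). Then for all 0≤r≤s<T one has exp(−∫_r^s A(u)/(2η(u)) du) ≤ ((T−s+ε)/(T−r+ε))^{η⋆/‖η‖}. -/
open MeasureTheory Set Filter Real
open scoped Topology

/-- The integral of `1 / (c - u)` over an interval lying to the left of `c`. -/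
theorem integral_one_div_sub_left {c r s : ℝ} (hrs : r ≤ s) (hs : s < c) :
    ∫ u in r..s, 1 / (c - u) = Real.log ((c - r) / (c - s)) := by
  rw [intervalIntegral.integral_comp_sub_left (fun x => 1 / x) c]
  exact integral_one_div_of_pos (by linarith) (by linarith)

/-- Dividing an interval integrable function by a measurable function bounded below by a positive
constant preserves interval integrability. -/
theorem IntervalIntegrable.div_of_le {f g : ℝ → ℝ} {r s c : ℝ} (hrs : r ≤ s)
    (hf : IntervalIntegrable f volume r s) (hg : Measurable g) (hc : 0 < c)
    (hcg : ∀ u ∈ Icc r s, c ≤ g u) :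
    IntervalIntegrable (fun u => f u / g u) volume r s := by
  rw [intervalIntegrable_iff_integrableOn_Icc_of_le hrs] at hf ⊢
  refine Integrable.mono (hf.div_const c)
    (hf.aestronglyMeasurable.aemeasurable.div hg.aemeasurable).aestronglyMeasurable ?_
  filter_upwards [ae_restrict_mem measurableSet_Icc] with u hu
  rw [norm_div, norm_div, Real.norm_of_nonneg hc.le,
    Real.norm_of_nonneg (hc.le.trans (hcg u hu))]
  exact div_le_div_of_nonneg_left (norm_nonneg _) hc (hcg u hu)

/-- Pathwise discount-factor estimate: if `A u ≥ 2η⋆/(T-u+ε)` a.e. on `[0,T)` and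
`η⋆ ≤ η ≤ ‖η‖`, then `exp(-∫_r^s A/(2η)) ≤ ((T-s+ε)/(T-r+ε))^(η⋆/‖η‖)`. -/
theorem stmt_0 (T ε ηstar ηnorm : ℝ) (hT : 0 < T) (hε : 0 ≤ ε)
    (hηstar : 0 < ηstar) (hηnorm : ηstar ≤ ηnorm)
    (η A : ℝ → ℝ) (hηmeas : Measurable η)
    (hηlb : ∀ u ∈ Ico (0:ℝ) T, ηstar ≤ η u) (hηub : ∀ u ∈ Ico (0:ℝ) T, η u ≤ ηnorm)
    (hA0 : ∀ u ∈ Ico (0:ℝ) T, 0 ≤ A u)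
    (hAloc : LocallyIntegrableOn A (Ico (0:ℝ) T))
    (hAlb : ∀ᵐ u ∂(volume.restrict (Ico (0:ℝ) T)), 2 * ηstar / (T - u + ε) ≤ A u) :
    ∀ r s : ℝ, 0 ≤ r → r ≤ s → s < T →
      Real.exp (-∫ u in r..s, A u / (2 * η u)) ≤
        ((T - s + ε) / (T - r + ε)) ^ (ηstar / ηnorm) := by
  intro r s hr hrs hsT
  have hsub : Icc r s ⊆ Ico (0 : ℝ) T := fun u hu => ⟨hr.trans hu.1, hu.2.trans_lt hsT⟩
  have hηn : 0 < ηnorm := hηstar.trans_le hηnorm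
  have hA : IntervalIntegrable A volume r s :=
    (intervalIntegrable_iff_integrableOn_Icc_of_le hrs).2
      (hAloc.integrableOn_compact_subset hsub isCompact_Icc)
  have hquot : IntervalIntegrable (fun u => A u / (2 * η u)) volume r s :=
    hA.div_of_le hrs (hηmeas.const_mul 2) (c := 2 * ηstar) (by linarith)
      fun u hu => by linarith [hηlb u (hsub hu)]
  have hker : IntervalIntegrable (fun u => ηstar / ηnorm * (1 / (T + ε - u))) volume r s := by
    refine ContinuousOn.intervalIntegrable_of_Icc hrs ?_
    refine continuousOn_const.mul (continuousOn_const.div (by fun_prop) fun u hu => ?_)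
    exact (by linarith [hu.2] : 0 < T + ε - u).ne'
  have hle : ∫ u in r..s, ηstar / ηnorm * (1 / (T + ε - u)) ≤
      ∫ u in r..s, A u / (2 * η u) := by
    refine intervalIntegral.integral_mono_ae_restrict hrs hker hquot ?_
    filter_upwards [ae_restrict_of_ae_restrict_of_subset hsub hAlb,
      ae_restrict_mem measurableSet_Icc] with u hAu hu
    have hη := hηlb u (hsub hu)
    calc ηstar / ηnorm * (1 / (T + ε - u))
        = 2 * ηstar / (T - u + ε) / (2 * ηnorm) := by
          rw [show T + ε - u = T - u + ε by ring]
          ring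
      _ ≤ A u / (2 * ηnorm) := by gcongr
      _ ≤ A u / (2 * η u) :=
          div_le_div_of_nonneg_left (hA0 u (hsub hu)) (by linarith)
            (by linarith [hηub u (hsub hu)])
  rw [intervalIntegral.integral_const_mul,
    integral_one_div_sub_left hrs (by linarith : s < T + ε)] at hle
  have hs0 : 0 < T - s + ε := by linarith
  have hr0 : 0 < T - r + ε := by linarith
  rw [Real.rpow_def_of_pos (div_pos hs0 hr0), Real.exp_le_exp, ← inv_div, Real.log_inv,
    show T - s + ε = T + ε - s by ring, show T - r + ε = T + ε - r by ring]
  linarith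
end

section
/- Let T>0 and let λ,η:[0,T]→ℝ be continuous with λ(t)≥0 and 0<η⋆≤η(t)≤‖η‖ for all t. If A:[0,T)→ℝ is continuously differentiable, satisfies A'(t)=A(t)²/(2η(t))−2λ(t) for all t∈[0,T), and A(t)→+∞ as t→T⁻, then for every t∈[0,T): 1/∫_t^T (2η(s))⁻¹ ds ≤ A(t) ≤ (T−t)⁻² ∫_t^T (2η(s)+2(T−s)²λ(s)) ds. -/
open MeasureTheory Set Filter Real
open scoped Topology

/-- A function with `A' ≤ c * A ^ 2` that is nonpositive at `a` stays nonpositive. -/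
lemma nonpos_of_deriv_le_mul_sq {A A' : ℝ → ℝ} {a b c : ℝ} (hab : a ≤ b) (hc : 0 ≤ c)
    (hA : ContinuousOn A (Icc a b))
    (hd : ∀ x ∈ Ico a b, HasDerivWithinAt A (A' x) (Ici x) x)
    (hle : ∀ x ∈ Ico a b, A' x ≤ c * A x ^ 2) (ha : A a ≤ 0) : A b ≤ 0 := by
  obtain ⟨M, hM⟩ := isCompact_Icc.exists_bound_of_continuousOn hA
  set K := c * M + 1
  have key : ∀ ε > 0, A b ≤ ε * exp (K * (b - a)) := by
    intro ε hε
    refine image_le_of_deriv_right_lt_deriv_boundary (B := fun x => ε * exp (K * (x - a)))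
      (B' := fun x => ε * (exp (K * (x - a)) * K)) hA hd ?_ ?_ ?_ (right_mem_Icc.2 hab)
    · have := mul_pos hε (exp_pos (K * (a - a)))
      exact ha.trans this.le
    · intro x
      have h : HasDerivAt (fun x => K * (x - a)) K x := by
        simpa using ((hasDerivAt_id x).sub_const a).const_mul K
      exact h.exp.const_mul ε
    · intro x hx hAx
      have hpos : 0 < A x := by rw [hAx]; positivity
      have hAM : A x ≤ M := (le_abs_self _).trans (hM x (Ico_subset_Icc_self hx))
      have h1 : ε * (exp (K * (x - a)) * K) = A x * (c * M + 1) := by rw [hAx]; ring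
      rw [h1]
      have h2 : c * A x ^ 2 ≤ A x * (c * M) := by
        have := mul_le_mul_of_nonneg_left hAM (mul_nonneg hc hpos.le)
        linarith
      linarith [hle x hx]
  refine le_of_forall_pos_le_add fun δ hδ => ?_
  have h := key (δ / exp (K * (b - a))) (by positivity)
  rwa [div_mul_cancel₀ _ (exp_ne_zero _), ← zero_add δ] at h

/-- Two-sided a priori estimate for the singular Riccati equation
`A' = A²/(2η) - 2λ` with `A(t) → ∞` as `t → T⁻`. -/
theorem stmt_1 (T ηstar ηnorm : ℝ) (hT : 0 < T) (hηstar : 0 < ηstar) (hηnorm : ηstar ≤ ηnorm)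
    (lam η : ℝ → ℝ) (hlamc : ContinuousOn lam (Icc 0 T)) (hηc : ContinuousOn η (Icc 0 T))
    (hlam0 : ∀ t ∈ Icc (0:ℝ) T, 0 ≤ lam t)
    (hηlb : ∀ t ∈ Icc (0:ℝ) T, ηstar ≤ η t) (hηub : ∀ t ∈ Icc (0:ℝ) T, η t ≤ ηnorm)
    (A : ℝ → ℝ)
    (hAode : ∀ t ∈ Ico (0:ℝ) T,
      HasDerivWithinAt A ((A t) ^ 2 / (2 * η t) - 2 * lam t) (Ico (0:ℝ) T) t)
    (hAblow : Tendsto A (𝓝[<] T) atTop) :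
    ∀ t ∈ Ico (0:ℝ) T,
      1 / (∫ s in t..T, (2 * η s)⁻¹) ≤ A t ∧
      A t ≤ (∫ s in t..T, (2 * η s + 2 * (T - s) ^ 2 * lam s)) / (T - t) ^ 2 := by
  have hηpos : ∀ s ∈ Icc (0:ℝ) T, 0 < η s := fun s hs => hηstar.trans_le (hηlb s hs)
  have hAc : ContinuousOn A (Ico 0 T) := fun t ht => (hAode t ht).continuousWithinAt
  have hAd : ∀ x ∈ Ico (0:ℝ) T,
      HasDerivWithinAt A ((A x) ^ 2 / (2 * η x) - 2 * lam x) (Ici x) x := fun x hx =>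
    (hAode x hx).mono_of_mem_nhdsWithin
      (mem_of_superset (Ico_mem_nhdsGE hx.2) (Ico_subset_Ico_left hx.1))
  intro t ht
  have hsub : Icc t T ⊆ Icc 0 T := Icc_subset_Icc_left ht.1
  have hsubr : ∀ {r}, r < T → Icc t r ⊆ Ico 0 T := fun hr x hx =>
    ⟨ht.1.trans hx.1, hx.2.trans_lt hr⟩
  have hnear : ∀ᶠ r in 𝓝[<] T, r ∈ Ioo t T := Ioo_mem_nhdsLT ht.2
  have hinvc : ContinuousOn (fun s => (2 * η s)⁻¹) (Icc 0 T) :=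
    (continuousOn_const.mul hηc).inv₀ fun s hs =>
      mul_ne_zero two_ne_zero (hηpos s hs).ne'
  have hquadc : ContinuousOn (fun s => 2 * η s + 2 * (T - s) ^ 2 * lam s) (Icc 0 T) := by
    fun_prop
  have integral_le : ∀ {f : ℝ → ℝ} {r}, ContinuousOn f (Icc 0 T) →
      (∀ s ∈ Icc (0:ℝ) T, 0 ≤ f s) → r ∈ Ioo t T →
      ∫ s in t..r, f s ≤ ∫ s in t..T, f s := by
    intro f r hf hf0 hr
    refine intervalIntegral.integral_mono_interval le_rfl hr.1.le hr.2.le ?_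
      ((hf.mono hsub).intervalIntegrable_of_Icc ht.2.le)
    filter_upwards [ae_restrict_mem measurableSet_Ioc] with s hs
    exact hf0 s (hsub (Ioc_subset_Icc_self hs))
  constructor
  · have hApos : ∀ x ∈ Ico (0:ℝ) T, 0 < A x := by
      intro x hx
      by_contra! hneg
      obtain ⟨r, hr, hAr⟩ :=
        (Filter.Eventually.and (Ioo_mem_nhdsLT hx.2)
          (hAblow.eventually_gt_atTop 0)).exists
      have hI : Icc x r ⊆ Ico 0 T := fun y hy => ⟨hx.1.trans hy.1, hy.2.trans_lt hr.2⟩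
      refine hAr.not_ge (nonpos_of_deriv_le_mul_sq (c := (2 * ηstar)⁻¹) hr.1.le (by positivity)
        (hAc.mono hI) (fun y hy => hAd y (hI (Ico_subset_Icc_self hy))) (fun y hy => ?_) hneg)
      have hyT := Ico_subset_Icc_self (hI (Ico_subset_Icc_self hy))
      have h1 : (A y) ^ 2 / (2 * η y) ≤ (A y) ^ 2 / (2 * ηstar) := by
        gcongr
        exact hηlb y hyT
      rw [inv_mul_eq_div]
      linarith [hlam0 y hyT]
    have hinv : ∀ᶠ r in 𝓝[<] T, (A t)⁻¹ - (A r)⁻¹ ≤ ∫ s in t..T, (2 * η s)⁻¹ := by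
      filter_upwards [hnear] with r hr
      have hI := hsubr hr.2
      refine le_trans ?_ (integral_le hinvc
        (fun s hs => by have := hηpos s hs; positivity) hr)
      have h := intervalIntegral.sub_le_integral_of_hasDeriv_right_of_le
        (g := fun s => -(A s)⁻¹)
        (g' := fun s => -(-((A s) ^ 2 / (2 * η s) - 2 * lam s) / (A s) ^ 2))
        (φ := fun s => (2 * η s)⁻¹) hr.1.le
        ((hAc.mono hI).inv₀ fun s hs => (hApos s (hI hs)).ne').neg
        (fun s hs => ((hAd s (hI (Ioo_subset_Icc_self hs))).Ioi_of_Ici.fun_inv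
          (hApos s (hI (Ioo_subset_Icc_self hs))).ne').fun_neg)
        (hinvc.mono (hI.trans Ico_subset_Icc_self)).integrableOn_Icc ?_
      · linarith
      · intro s hs
        have hs' := hI (Ioo_subset_Icc_self hs)
        have hA := hApos s hs'
        have hη := hηpos s (Ico_subset_Icc_self hs')
        have hl := hlam0 s (Ico_subset_Icc_self hs')
        have heq : -(-((A s) ^ 2 / (2 * η s) - 2 * lam s) / (A s) ^ 2)
            = (2 * η s)⁻¹ - 2 * lam s / (A s) ^ 2 := by
          field_simp
        rw [heq]
        have : 0 ≤ 2 * lam s / (A s) ^ 2 := by positivity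
        linarith
    have hlim : Tendsto (fun r => (A t)⁻¹ - (A r)⁻¹) (𝓝[<] T) (𝓝 ((A t)⁻¹ - 0)) :=
      tendsto_const_nhds.sub hAblow.inv_tendsto_atTop
    have h := le_of_tendsto hlim hinv
    rw [sub_zero] at h
    rw [one_div]
    exact inv_le_of_inv_le₀ (hApos t ht) h
  · have hTt : 0 < T - t := sub_pos.2 ht.2
    rw [le_div_iff₀ (by positivity)]
    have hmul : ∀ᶠ r in 𝓝[<] T,
        A t * (r - t) ^ 2 ≤ ∫ s in t..T, (2 * η s + 2 * (T - s) ^ 2 * lam s) := by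
      filter_upwards [hnear] with r hr
      have hI := hsubr hr.2
      refine le_trans ?_ (integral_le hquadc (fun s hs => by
        have := hηpos s hs
        have := hlam0 s hs
        positivity) hr)
      have h := intervalIntegral.sub_le_integral_of_hasDeriv_right_of_le
        (g := fun s => -(A s * (r - s) ^ 2))
        (g' := fun s => -(((A s) ^ 2 / (2 * η s) - 2 * lam s) * (r - s) ^ 2
          + A s * (-2 * (r - s))))
        (φ := fun s => 2 * η s + 2 * (T - s) ^ 2 * lam s) hr.1.le
        ((hAc.mono hI).mul (by fun_prop)).neg
        (fun s hs => ?_)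
        (hquadc.mono (hI.trans Ico_subset_Icc_self)).integrableOn_Icc ?_
      · simp only [sub_self] at h
        linarith
      · have hsq : HasDerivAt (fun s => (r - s) ^ 2) (-2 * (r - s)) s := by
          refine (((hasDerivAt_id' s).const_sub r).fun_pow 2).congr_deriv ?_
          norm_num
        exact ((hAd s (hI (Ioo_subset_Icc_self hs))).Ioi_of_Ici.fun_mul
          hsq.hasDerivWithinAt).fun_neg
      · intro s hs
        have hs' := Ico_subset_Icc_self (hI (Ioo_subset_Icc_self hs))
        have hη := hηpos s hs'
        have hl := hlam0 s hs'
        have hsquare : 0 ≤ (A s * (r - s) - 2 * η s) ^ 2 / (2 * η s) := by positivity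
        have heq : (A s * (r - s) - 2 * η s) ^ 2 / (2 * η s)
            = (A s) ^ 2 / (2 * η s) * (r - s) ^ 2 - 2 * (A s * (r - s)) + 2 * η s := by
          field_simp
          ring
        have hmono : (r - s) ^ 2 * lam s ≤ (T - s) ^ 2 * lam s := by
          gcongr
          · linarith [hs.2]
          · exact hr.2.le
        linarith
    have hcont : Continuous fun r => A t * (r - t) ^ 2 := by fun_prop
    exact le_of_tendsto (hcont.continuousAt.mono_left nhdsWithin_le_nhds) hmul
end

section
/- Let T>0 and let λ,η:[0,T]→ℝ be continuous with λ(t)≥0 and 0<η⋆≤η(t)≤‖η‖ for all t. Then there exists exactly one continuously differentiable function A:[0,T)→ℝ such that A'(t)=A(t)²/(2η(t))−2λ(t) for all t∈[0,T) and A(t)→+∞ as t→T⁻. -/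
open MeasureTheory Set Filter Real
open scoped Topology

/-- A solution of `D' = k D` with `k` bounded below that tends to zero at the right endpoint
vanishes. -/
theorem eq_zero_of_deriv_eq_mul_of_tendsto_zero {D k : ℝ → ℝ} {s e K : ℝ}
    (hD : ∀ t ∈ Ico s e, HasDerivWithinAt D (k t * D t) (Ico s e) t)
    (hk : ∀ t ∈ Ico s e, -K ≤ k t) (hlim : Tendsto D (𝓝[<] e) (𝓝 0)) :
    ∀ t ∈ Ico s e, D t = 0 := by
  set F : ℝ → ℝ := fun t => D t ^ 2 * exp (2 * K * t)
  have hF : ∀ t ∈ Ico s e,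
      HasDerivWithinAt F (2 * (k t + K) * D t ^ 2 * exp (2 * K * t)) (Ico s e) t := by
    intro t ht
    have h1 := (hD t ht).pow 2
    have h2 : HasDerivWithinAt (fun t : ℝ => exp (2 * K * t)) (exp (2 * K * t) * (2 * K))
        (Ico s e) t := by
      simpa using ((hasDerivAt_id t).const_mul (2 * K)).exp.hasDerivWithinAt
    refine (h1.mul h2).congr_deriv ?_
    simp only [Pi.pow_apply]
    push_cast
    ring
  have hmono : MonotoneOn F (Ico s e) := by
    refine monotoneOn_of_hasDerivWithinAt_nonneg (convex_Ico s e)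
      (fun t ht => (hF t ht).continuousWithinAt)
      (fun t ht => (hF t (interior_subset ht)).mono interior_subset) fun t ht => ?_
    have := hk t (interior_subset ht)
    have : 0 ≤ k t + K := by linarith
    positivity
  have hFlim : Tendsto F (𝓝[<] e) (𝓝 0) := by
    have h2 : Tendsto (fun t : ℝ => exp (2 * K * t)) (𝓝[<] e) (𝓝 (exp (2 * K * e))) :=
      ((by fun_prop : Continuous fun t : ℝ => exp (2 * K * t)).tendsto e).mono_left
        nhdsWithin_le_nhds
    simpa using (hlim.pow 2).mul h2
  intro t ht
  have hle : F t ≤ 0 := by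
    refine ge_of_tendsto hFlim ?_
    filter_upwards [Ioo_mem_nhdsLT ht.2] with r hr
    exact hmono ht ⟨ht.1.trans hr.1.le, hr.2⟩ hr.1.le
  have hsq : D t ^ 2 ≤ 0 := nonpos_of_mul_nonpos_left hle (exp_pos _)
  exact pow_eq_zero_iff two_ne_zero |>.1 (le_antisymm hsq (sq_nonneg _))

/-- The field `b y² - a`, truncated in `y` to `[0, M]`, has a solution vanishing at the right
endpoint of the time interval. -/
theorem exists_truncated_riccati_solution {T M : ℝ} (hT : 0 ≤ T) (hM : 0 ≤ M) {a b : ℝ → ℝ}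
    (ha : ContinuousOn a (Icc 0 T)) (hb : ContinuousOn b (Icc 0 T)) :
    ∃ y : ℝ → ℝ, y T = 0 ∧ ∀ t ∈ Icc 0 T,
      HasDerivWithinAt y (b t * max 0 (min (y t) M) ^ 2 - a t) (Icc 0 T) t := by
  obtain ⟨Ca, hCa⟩ := isCompact_Icc.exists_bound_of_continuousOn ha
  obtain ⟨Cb, hCb⟩ := isCompact_Icc.exists_bound_of_continuousOn hb
  have hT0 : (0 : ℝ) ∈ Icc 0 T := ⟨le_rfl, hT⟩
  have hCa0 : 0 ≤ Ca := (norm_nonneg _).trans (hCa 0 hT0)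
  have hCb0 : 0 ≤ Cb := (norm_nonneg _).trans (hCb 0 hT0)
  have hc0 : ∀ x : ℝ, 0 ≤ max 0 (min x M) := fun x => le_max_left _ _
  have hcM : ∀ x : ℝ, max 0 (min x M) ≤ M := fun x => max_le hM (min_le_right _ _)
  have hL : 0 ≤ Cb * M ^ 2 + Ca := by positivity
  have hPL : IsPicardLindelof (fun t x => b t * max 0 (min x M) ^ 2 - a t)
      (⟨T, hT, le_rfl⟩ : Icc (0 : ℝ) T) (0 : ℝ) (.mk ((Cb * M ^ 2 + Ca) * T) (by positivity)) 0
      (.mk (Cb * M ^ 2 + Ca) hL) (.mk (Cb * (2 * M)) (by positivity)) := by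
    refine ⟨fun t ht => LipschitzOnWith.of_dist_le_mul fun x _ z _ => ?_, fun x _ => ?_,
      fun t ht x _ => ?_, ?_⟩
    · have hcl : |max 0 (min x M) - max 0 (min z M)| ≤ |x - z| :=
        calc
          _ = |max (min x M) 0 - max (min z M) 0| := by rw [max_comm, max_comm 0]
          _ ≤ |min x M - min z M| := abs_max_sub_max_le_abs _ _ _
          _ ≤ |x - z| := by simpa using abs_min_sub_min_le_max x M z M
      rw [Real.dist_eq, Real.dist_eq, NNReal.coe_mk,
        show b t * max 0 (min x M) ^ 2 - a t - (b t * max 0 (min z M) ^ 2 - a t)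
          = b t * (max 0 (min x M) + max 0 (min z M)) * (max 0 (min x M) - max 0 (min z M)) by
          ring, abs_mul, abs_mul, abs_of_nonneg (add_nonneg (hc0 x) (hc0 z))]
      have := hCb t ht
      rw [Real.norm_eq_abs] at this
      have := hcM x
      have := hcM z
      have := hc0 x
      have := hc0 z
      gcongr
      linarith
    · exact (hb.mul continuousOn_const).sub ha
    · have h1 := hCa t ht
      have h2 := hCb t ht
      have h3 := hcM x
      have h4 := hc0 x
      refine (norm_sub_le _ _).trans ?_
      rw [norm_mul, NNReal.coe_mk, norm_pow, Real.norm_of_nonneg h4]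
      gcongr
    · simp [hT]
  exact hPL.exists_eq_forall_mem_Icc_hasDerivWithinAt₀

/-- The equation `y' = b y² - a` with `a > 0` and `b ≥ 0` has a solution vanishing at the right
endpoint and positive before it. -/
theorem exists_pos_riccati_solution {T : ℝ} (hT : 0 ≤ T) {a b : ℝ → ℝ}
    (ha : ContinuousOn a (Icc 0 T)) (hb : ContinuousOn b (Icc 0 T))
    (ha0 : ∀ t ∈ Icc 0 T, 0 < a t) (hb0 : ∀ t ∈ Icc 0 T, 0 ≤ b t) :
    ∃ y : ℝ → ℝ, y T = 0 ∧ (∀ t ∈ Ico 0 T, 0 < y t) ∧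
      ∀ t ∈ Icc 0 T, HasDerivWithinAt y (b t * y t ^ 2 - a t) (Icc 0 T) t := by
  obtain ⟨C, hC⟩ := isCompact_Icc.exists_bound_of_continuousOn ha
  have hC0 : 0 ≤ C := (norm_nonneg _).trans (hC 0 ⟨le_rfl, hT⟩)
  obtain ⟨y, hyT, hy⟩ := exists_truncated_riccati_solution hT (mul_nonneg hC0 hT) ha hb
  have hyc : ContinuousOn y (Icc 0 T) := fun t ht => (hy t ht).continuousWithinAt
  have hright : ∀ t ∈ Ico 0 T,
      HasDerivWithinAt y (b t * max 0 (min (y t) (C * T)) ^ 2 - a t) (Ici t) t := fun t ht =>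
    (hy t ⟨ht.1, ht.2.le⟩).mono_of_mem_nhdsWithin
      (mem_of_superset (Icc_mem_nhdsGE ht.2) (Icc_subset_Icc_left ht.1))
  have hpos : ∀ t ∈ Ico 0 T, 0 < y t := by
    intro t ht
    by_contra! hyt
    have hnonpos : ∀ ⦃x⦄, x ∈ Icc t T → y x ≤ 0 :=
      image_le_of_deriv_right_lt_deriv_boundary (hyc.mono (Icc_subset_Icc_left ht.1))
        (fun x hx => hright x ⟨ht.1.trans hx.1, hx.2⟩) hyt (fun x => hasDerivAt_const x (0 : ℝ))
        fun x hx hx0 => by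
          have := ha0 x ⟨ht.1.trans hx.1, hx.2.le⟩
          simpa [hx0, mul_nonneg hC0 hT] using this
    have hanti : StrictAntiOn y (Icc t T) := by
      refine strictAntiOn_of_hasDerivWithinAt_neg (convex_Icc t T)
        (hyc.mono (Icc_subset_Icc_left ht.1))
        (fun x hx => (hy x (Icc_subset_Icc_left ht.1 (interior_subset hx))).mono
          (interior_subset.trans (Icc_subset_Icc_left ht.1))) fun x hx => ?_
      have hx' := interior_subset hx
      have := ha0 x (Icc_subset_Icc_left ht.1 hx')
      rw [max_eq_left ((min_le_left _ _).trans (hnonpos hx'))]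
      simpa using this
    have := hanti ⟨le_rfl, ht.2.le⟩ ⟨ht.2.le, le_rfl⟩ ht.2
    linarith
  have hle : ∀ t ∈ Icc 0 T, y t ≤ C * T := by
    intro t ht
    have hdB : ∀ x : ℝ, HasDerivAt (fun x => -y t + C * (x - t)) C x := fun x => by
      simpa using (((hasDerivAt_id x).sub_const t).const_mul C).const_add (-y t)
    have h := image_le_of_deriv_right_le_deriv_boundary (f := fun x => -y x)
      (B := fun x => -y t + C * (x - t)) (B' := fun _ => C) (a := t) (b := T)
      (hyc.mono (Icc_subset_Icc_left ht.1)).neg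
      (fun x hx => (hright x ⟨ht.1.trans hx.1, hx.2⟩).neg) (by simp)
      (fun x _ => (hdB x).continuousAt.continuousWithinAt)
      (fun x _ => (hdB x).hasDerivWithinAt)
      (fun x hx => by
        have hx' : x ∈ Icc 0 T := ⟨ht.1.trans hx.1, hx.2.le⟩
        have h1 := (le_abs_self _).trans (hC x hx')
        have h2 := mul_nonneg (hb0 x hx') (sq_nonneg (max 0 (min (y x) (C * T))))
        linarith) (⟨ht.2, le_rfl⟩ : T ∈ Icc t T)
    have := mul_nonneg hC0 ht.1
    simp only [hyT] at h
    nlinarith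
  refine ⟨y, hyT, hpos, fun t ht => ?_⟩
  have hy0 : 0 ≤ y t := by
    rcases ht.2.eq_or_lt with rfl | h
    · exact hyT.ge
    · exact (hpos t ⟨ht.1, h⟩).le
  simpa [min_eq_left (hle t ht), max_eq_right hy0] using hy t ht

/-- Two solutions of `A' = a A² - b` which blow up at the right endpoint coincide. -/
theorem eqOn_of_riccati_of_tendsto_atTop {T : ℝ} (hT : 0 < T) {a b A B : ℝ → ℝ}
    (ha : ContinuousOn a (Icc 0 T)) (hb0 : ∀ t ∈ Icc 0 T, 0 ≤ b t)
    (hA : ∀ t ∈ Ico 0 T, HasDerivWithinAt A (a t * A t ^ 2 - b t) (Ico 0 T) t)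
    (hB : ∀ t ∈ Ico 0 T, HasDerivWithinAt B (a t * B t ^ 2 - b t) (Ico 0 T) t)
    (hAlim : Tendsto A (𝓝[<] T) atTop) (hBlim : Tendsto B (𝓝[<] T) atTop) :
    EqOn B A (Ico 0 T) := by
  obtain ⟨s, hs, hpos⟩ : ∃ s ∈ Ico 0 T, ∀ t ∈ Ico s T, 0 < A t ∧ 0 < B t := by
    obtain ⟨l, hl, hsub⟩ := (mem_nhdsLT_iff_exists_Ico_subset).1
      ((hAlim.eventually_gt_atTop 0).and (hBlim.eventually_gt_atTop 0))
    exact ⟨max l 0, ⟨le_max_right _ _, max_lt hl hT⟩,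
      fun t ht => hsub ⟨(le_max_left _ _).trans ht.1, ht.2⟩⟩
  have hsub : Ico s T ⊆ Ico 0 T := Ico_subset_Ico_left hs.1
  have hend : ∀ t ∈ Ico s T, B t = A t := by
    intro t ht
    have h := eq_zero_of_deriv_eq_mul_of_tendsto_zero (D := fun t => (A t)⁻¹ - (B t)⁻¹)
      (k := fun t => b t * ((A t)⁻¹ + (B t)⁻¹)) (s := s) (e := T) (K := 0)
      (fun r hr => by
        obtain ⟨h1, h2⟩ := hpos r hr
        refine ((((hA r (hsub hr)).mono hsub).inv h1.ne').sub
          (((hB r (hsub hr)).mono hsub).inv h2.ne')).congr_deriv ?_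
        field_simp
        ring)
      (fun r hr => by
        obtain ⟨h1, h2⟩ := hpos r hr
        have := hb0 r ⟨(hsub hr).1, hr.2.le⟩
        rw [neg_zero]
        positivity)
      (by simpa using hAlim.inv_tendsto_atTop.sub hBlim.inv_tendsto_atTop) t ht
    exact (inv_inj.1 (sub_eq_zero.1 h)).symm
  intro t ht
  rcases le_or_gt s t with hst | hts
  · exact hend t ⟨hst, ht.2⟩
  have hsT : Icc 0 s ⊆ Ico 0 T := fun x hx => ⟨hx.1, hx.2.trans_lt hs.2⟩
  have hAc : ContinuousOn A (Icc 0 s) := fun x hx =>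
    ((hA x (hsT hx)).continuousWithinAt).mono hsT
  have hBc : ContinuousOn B (Icc 0 s) := fun x hx =>
    ((hB x (hsT hx)).continuousWithinAt).mono hsT
  obtain ⟨K, hK⟩ := isCompact_Icc.exists_bound_of_continuousOn
    ((ha.mono (Icc_subset_Icc_right hs.2.le)).mul (hAc.add hBc))
  have hs0 : 0 < s := ht.1.trans_lt hts
  have hsub' : Ico 0 s ⊆ Ico 0 T := Ico_subset_Ico_right hs.2.le
  refine sub_eq_zero.1 (eq_zero_of_deriv_eq_mul_of_tendsto_zero (D := fun t => B t - A t)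
    (k := fun t => a t * (A t + B t)) (s := 0) (e := s) (K := K)
    (fun r hr => ?_) (fun r hr => ?_) ?_ t ⟨ht.1, hts⟩)
  · refine (((hB r (hsub' hr)).mono hsub').sub ((hA r (hsub' hr)).mono hsub')).congr_deriv ?_
    ring
  · exact (abs_le.1 (hK r ⟨hr.1, hr.2.le⟩)).1
  · have h := (hBc.sub hAc) s ⟨hs0.le, le_rfl⟩
    have h0 : B s - A s = 0 := sub_eq_zero.2 (hend s ⟨le_rfl, hs.2⟩)
    rw [← h0]
    exact h.mono_left (nhdsWithin_le_of_mem (Icc_mem_nhdsLT hs0))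

/-- Existence and uniqueness (on `[0,T)`) for the singular Riccati equation
`A' = A²/(2η) - 2λ`, `A(T⁻) = ∞`. -/
theorem stmt_2 (T ηstar ηnorm : ℝ) (hT : 0 < T) (hηstar : 0 < ηstar) (hηnorm : ηstar ≤ ηnorm)
    (lam η : ℝ → ℝ) (hlamc : ContinuousOn lam (Icc 0 T)) (hηc : ContinuousOn η (Icc 0 T))
    (hlam0 : ∀ t ∈ Icc (0:ℝ) T, 0 ≤ lam t)
    (hηlb : ∀ t ∈ Icc (0:ℝ) T, ηstar ≤ η t) (hηub : ∀ t ∈ Icc (0:ℝ) T, η t ≤ ηnorm) :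
    ∃ A : ℝ → ℝ,
      ((∀ t ∈ Ico (0:ℝ) T,
          HasDerivWithinAt A ((A t) ^ 2 / (2 * η t) - 2 * lam t) (Ico (0:ℝ) T) t) ∧
        Tendsto A (𝓝[<] T) atTop) ∧
      ∀ B : ℝ → ℝ,
        ((∀ t ∈ Ico (0:ℝ) T,
            HasDerivWithinAt B ((B t) ^ 2 / (2 * η t) - 2 * lam t) (Ico (0:ℝ) T) t) ∧
          Tendsto B (𝓝[<] T) atTop) →
        EqOn B A (Ico (0:ℝ) T) := by
  have hη0 : ∀ t ∈ Icc (0 : ℝ) T, 0 < η t := fun t ht => hηstar.trans_le (hηlb t ht)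
  have hac : ContinuousOn (fun t => (2 * η t)⁻¹) (Icc 0 T) :=
    (continuousOn_const.mul hηc).inv₀ fun t ht => (mul_pos two_pos (hη0 t ht)).ne'
  have hbc : ContinuousOn (fun t => 2 * lam t) (Icc 0 T) := continuousOn_const.mul hlamc
  have hb0 : ∀ t ∈ Icc (0 : ℝ) T, 0 ≤ 2 * lam t := fun t ht =>
    mul_nonneg zero_le_two (hlam0 t ht)
  obtain ⟨y, hyT, hpos, hy⟩ := exists_pos_riccati_solution hT.le hac hbc
    (fun t ht => by have := hη0 t ht; positivity) hb0
  simp_rw [div_eq_inv_mul]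
  have hA : ∀ t ∈ Ico 0 T, HasDerivWithinAt y⁻¹
      ((2 * η t)⁻¹ * (y⁻¹ t) ^ 2 - 2 * lam t) (Ico 0 T) t := by
    intro t ht
    have h0 := (hpos t ht).ne'
    refine (((hy t ⟨ht.1, ht.2.le⟩).mono Ico_subset_Icc_self).inv h0).congr_deriv ?_
    simp only [Pi.inv_apply]
    field_simp
    ring
  have hAlim : Tendsto y⁻¹ (𝓝[<] T) atTop := by
    refine Tendsto.inv_tendsto_nhdsGT_zero (tendsto_nhdsWithin_iff.2 ⟨?_, ?_⟩)
    · have h := (hy T ⟨hT.le, le_rfl⟩).continuousWithinAt.tendsto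
      rw [hyT] at h
      exact h.mono_left (nhdsWithin_le_of_mem (Icc_mem_nhdsLT hT))
    · filter_upwards [Ico_mem_nhdsLT hT] with t ht using hpos t ht
  exact ⟨y⁻¹, ⟨hA, hAlim⟩, fun B hB =>
    eqOn_of_riccati_of_tendsto_atTop hT hac hb0 hA hB.1 hAlim hB.2⟩
end

section
/- Let T>0, x≥0, and 0<η⋆≤‖η‖, ‖κ‖≥0, ‖λ‖≥0; set α=η⋆/‖η‖. Let η:[0,T)→ℝ be measurable with η⋆≤η(t)≤‖η‖, and let A:[0,T)→(0,∞) be measurable with 2η⋆/(T−t) ≤ A(t) ≤ (2/(T−t)) e^{‖κ‖T/(2η⋆)} (‖η‖+‖λ‖T²/3) for all t∈[0,T). Define X*(t)=x·exp(−∫_0^t A(r)/(2η(r))dr) and ξ*(t)=A(t)X*(t)/(2η(t)). Then for all t∈[0,T): 0 ≤ X*(t) ≤ x((T−t)/T)^α and 0 ≤ ξ*(t) ≤ (x/(η⋆T^α))(‖η‖+‖λ‖T²/3) e^{‖κ‖T/(2η⋆)} (T−t)^{α−1}. -/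
open MeasureTheory Set Filter Real
open scoped Topology

/-- The primitive of `r ↦ c / (T - r)` starting at `0` is `c * log (T / (T - t))`. -/
theorem integral_const_div_sub {T t : ℝ} (c : ℝ) (hT : 0 < T) (htT : t < T) :
    ∫ r in (0:ℝ)..t, c / (T - r) = c * Real.log (T / (T - t)) := by
  simp_rw [div_eq_mul_inv c]
  rw [intervalIntegral.integral_const_mul,
    intervalIntegral.integral_comp_sub_left (fun r => r⁻¹) T, sub_zero,
    integral_inv_of_pos (sub_pos.2 htT) hT]

/-- If `f` dominates `r ↦ c / (T - r)` on `[0, t]`, then the exponential of minus its integral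
decays at least like a power of the remaining time. -/
theorem exp_neg_integral_le_rpow {T t c : ℝ} {f : ℝ → ℝ} (ht : 0 ≤ t) (htT : t < T)
    (hf : IntervalIntegrable f volume 0 t) (hlb : ∀ r ∈ Icc (0:ℝ) t, c / (T - r) ≤ f r) :
    Real.exp (-∫ r in (0:ℝ)..t, f r) ≤ ((T - t) / T) ^ c := by
  have hT : 0 < T := ht.trans_lt htT
  have hTt : 0 < T - t := sub_pos.2 htT
  have hint : IntervalIntegrable (fun r => c / (T - r)) volume 0 t := by
    refine ContinuousOn.intervalIntegrable ?_
    rw [uIcc_of_le ht]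
    exact continuousOn_const.div (by fun_prop) fun r hr => (by linarith [hr.2] : 0 < T - r).ne'
  have hmono := intervalIntegral.integral_mono_on ht hint hf hlb
  rw [integral_const_div_sub c hT htT] at hmono
  rw [Real.rpow_def_of_pos (div_pos hTt hT), Real.exp_le_exp, ← inv_div T, Real.log_inv]
  linarith

/-- Pathwise content of Lemma 2.12: bounds on the optimal position `X*` and
trading rate `ξ*` built from the singular Riccati solution `A`. -/
theorem stmt_6 (T x ηstar ηnorm κnorm lamnorm α : ℝ) (hT : 0 < T) (hx : 0 ≤ x)
    (hηstar : 0 < ηstar) (hηnorm : ηstar ≤ ηnorm) (hκnorm : 0 ≤ κnorm) (hlamnorm : 0 ≤ lamnorm)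
    (hα : α = ηstar / ηnorm)
    (η A : ℝ → ℝ) (hηm : Measurable η) (hAm : Measurable A)
    (hηlb : ∀ t ∈ Ico (0:ℝ) T, ηstar ≤ η t) (hηub : ∀ t ∈ Ico (0:ℝ) T, η t ≤ ηnorm)
    (hAlb : ∀ t ∈ Ico (0:ℝ) T, 2 * ηstar / (T - t) ≤ A t)
    (hAub : ∀ t ∈ Ico (0:ℝ) T,
      A t ≤ 2 / (T - t) * Real.exp (κnorm * T / (2 * ηstar)) * (ηnorm + lamnorm * T ^ 2 / 3))
    (Xstar ξstar : ℝ → ℝ)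
    (hX : ∀ t, Xstar t = x * Real.exp (-∫ r in (0:ℝ)..t, A r / (2 * η r)))
    (hξ : ∀ t, ξstar t = A t * Xstar t / (2 * η t)) :
    ∀ t ∈ Ico (0:ℝ) T,
      (0 ≤ Xstar t ∧ Xstar t ≤ x * ((T - t) / T) ^ α) ∧
      (0 ≤ ξstar t ∧ ξstar t ≤
        x / (ηstar * T ^ α) * (ηnorm + lamnorm * T ^ 2 / 3) *
          Real.exp (κnorm * T / (2 * ηstar)) * (T - t) ^ (α - 1)) := by
  rintro t ⟨ht0, htT⟩
  have hTt : 0 < T - t := sub_pos.2 htT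
  have hnorm : 0 < ηnorm := hηstar.trans_le hηnorm
  have hηpos : ∀ r ∈ Ico (0:ℝ) T, 0 < η r := fun r hr => hηstar.trans_le (hηlb r hr)
  have hApos : ∀ r ∈ Ico (0:ℝ) T, 0 < A r := fun r hr =>
    (div_pos (by positivity) (sub_pos.2 hr.2)).trans_le (hAlb r hr)
  set E := Real.exp (κnorm * T / (2 * ηstar))
  set C := ηnorm + lamnorm * T ^ 2 / 3
  have hEpos : 0 < E := Real.exp_pos _
  have hCpos : 0 < C := by positivity
  have hrate : ∀ r ∈ Ico (0:ℝ) T, A r / (2 * η r) ≤ 2 / (T - r) * E * C / (2 * ηstar) := by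
    intro r hr
    have := sub_pos.2 hr.2
    exact div_le_div₀ (by positivity) (hAub r hr) (by positivity) (by linarith [hηlb r hr])
  have hmem : ∀ r ∈ Icc (0:ℝ) t, r ∈ Ico (0:ℝ) T := fun r hr => ⟨hr.1, hr.2.trans_lt htT⟩
  have hint : IntervalIntegrable (fun r => A r / (2 * η r)) volume 0 t := by
    rw [intervalIntegrable_iff_integrableOn_Icc_of_le ht0]
    refine Measure.integrableOn_of_bounded (M := 2 / (T - t) * E * C / (2 * ηstar))
      measure_Icc_lt_top.ne (hAm.div (hηm.const_mul 2)).aestronglyMeasurable ?_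
    filter_upwards [ae_restrict_mem measurableSet_Icc] with r hr
    have hr' := hmem r hr
    have h1 := hηpos r hr'
    have h2 := hApos r hr'
    rw [Real.norm_of_nonneg (by positivity)]
    refine (hrate r hr').trans ?_
    have h3 := hr.2
    gcongr
  have hlb : ∀ r ∈ Icc (0:ℝ) t, α / (T - r) ≤ A r / (2 * η r) := by
    intro r hr
    have hr' := hmem r hr
    have h1 := hηpos r hr'
    have h2 := sub_pos.2 hr'.2
    calc α / (T - r) = 2 * ηstar / (T - r) / (2 * ηnorm) := by rw [hα]; field_simp
      _ ≤ A r / (2 * η r) :=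
        div_le_div₀ (hApos r hr').le (hAlb r hr') (by positivity) (by linarith [hηub r hr'])
  have hX0 : 0 ≤ Xstar t := by rw [hX]; positivity
  have hXle : Xstar t ≤ x * ((T - t) / T) ^ α := by
    rw [hX]
    exact mul_le_mul_of_nonneg_left (exp_neg_integral_le_rpow ht0 htT hint hlb) hx
  have hηt := hηpos t ⟨ht0, htT⟩
  have hAt := hApos t ⟨ht0, htT⟩
  refine ⟨⟨hX0, hXle⟩, by rw [hξ]; positivity, ?_⟩
  calc ξstar t = A t / (2 * η t) * Xstar t := by rw [hξ]; ring
    _ ≤ 2 / (T - t) * E * C / (2 * ηstar) * (x * ((T - t) / T) ^ α) :=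
      mul_le_mul (hrate t ⟨ht0, htT⟩) hXle hX0 (by positivity)
    _ = x / (ηstar * T ^ α) * C * E * (T - t) ^ (α - 1) := by
      rw [Real.div_rpow hTt.le hT.le, Real.rpow_sub_one hTt.ne']
      have := Real.rpow_pos_of_pos hT α
      field_simp
end

section
/- Let T>0 and 0<η⋆≤‖η‖. Let η:[0,T]→ℝ be measurable with η⋆≤η(u)≤‖η‖ for all u, and let A:[0,T)→[0,∞) be locally integrable with A(u)·∫_u^T (2η(s))⁻¹ ds ≥ 1 for almost every u∈[0,T). Then for all 0≤r≤s<T: exp(−∫_r^s A(u)/(2η(u)) du) ≤ (∫_s^T η(v)⁻¹ dv)/(∫_r^T η(v)⁻¹ dv) ≤ (‖η‖/η⋆)·(T−s)/(T−r). -/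
open MeasureTheory Set Filter Real
open scoped Topology

/-- The logarithm is Lipschitz on every half-line `[m, ∞)` with `m > 0`. -/
theorem Real.lipschitzOnWith_log_Ici {m : ℝ} (hm : 0 < m) :
    LipschitzOnWith (Real.toNNReal m⁻¹) Real.log (Ici m) := by
  refine (convex_Ici m).lipschitzOnWith_of_nnnorm_deriv_le
    (fun x hx => Real.differentiableAt_log (hm.trans_le hx).ne') fun x hx => ?_
  have hx0 : 0 < x := hm.trans_le hx
  rw [← NNReal.coe_le_coe, coe_nnnorm, Real.deriv_log, Real.norm_of_nonneg (by positivity),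
    Real.coe_toNNReal _ (by positivity)]
  exact inv_anti₀ hm hx

/-- A lower bound on the tail integrals of a function bounded below. -/
theorem mul_sub_le_intervalIntegral_of_le {g : ℝ → ℝ} {a b T c : ℝ}
    (hint : IntervalIntegrable g volume a T) (hlb : ∀ x ∈ Icc a T, c ≤ g x)
    (hab : a ≤ b) (hbT : b ≤ T) : c * (T - b) ≤ ∫ v in b..T, g v := by
  have h := intervalIntegral.integral_mono_on (μ := volume) (f := fun _ => c) hbT
    intervalIntegrable_const
    (hint.mono_set (by
      rw [uIcc_of_le hbT, uIcc_of_le (hab.trans hbT)]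
      exact Icc_subset_Icc_left hab))
    (fun x hx => hlb x ⟨hab.trans hx.1, hx.2⟩)
  simpa [mul_comm] using h

/-- The logarithmic derivative of the tail integral of a function bounded between two positive
constants integrates to the difference of the logarithms. -/
theorem integral_div_tail_integral_eq_log_sub_log {g : ℝ → ℝ} {a b T c C : ℝ} (hc : 0 < c)
    (hint : IntervalIntegrable g volume a T) (hlb : ∀ x ∈ Icc a T, c ≤ g x)
    (hub : ∀ x ∈ Icc a T, g x ≤ C) (hab : a ≤ b) (hbT : b < T) :
    IntervalIntegrable (fun u => g u / ∫ v in u..T, g v) volume a b ∧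
      ∫ u in a..b, g u / ∫ v in u..T, g v =
        Real.log (∫ v in a..T, g v) - Real.log (∫ v in b..T, g v) := by
  have haT : a ≤ T := hab.trans hbT.le
  have hsub {x y : ℝ} (hx : x ∈ Icc a T) (hy : y ∈ Icc a T) : IntervalIntegrable g volume x y :=
    hint.mono_set (by rw [uIcc_of_le haT]; exact uIcc_subset_Icc hx hy)
  have hT : T ∈ Icc a T := ⟨haT, le_rfl⟩
  set N : ℝ → ℝ := fun u => ∫ v in u..T, g v with hN
  have hmem {x : ℝ} (hx : x ∈ Icc a b) : x ∈ Icc a T := ⟨hx.1, hx.2.trans hbT.le⟩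
  have hm : 0 < c * (T - b) := mul_pos hc (sub_pos.2 hbT)
  have hNlb : ∀ x ∈ Icc a b, c * (T - b) ≤ N x := fun x hx =>
    (mul_le_mul_of_nonneg_left (by linarith [hx.2]) hc.le).trans
      (mul_sub_le_intervalIntegral_of_le hint hlb hx.1 (hmem hx).2)
  have hNlip : LipschitzOnWith (Real.toNNReal C) N (Icc a b) := by
    refine LipschitzOnWith.of_dist_le' fun x hx y hy => ?_
    have hxy : N x - N y = ∫ v in x..y, g v :=
      sub_eq_of_eq_add (intervalIntegral.integral_add_adjacent_intervals
        (hsub (hmem hx) (hmem hy)) (hsub (hmem hy) hT)).symm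
    rw [Real.dist_eq, Real.dist_eq, hxy, abs_sub_comm x y, ← Real.norm_eq_abs]
    refine intervalIntegral.norm_integral_le_of_norm_le_const fun v hv => ?_
    have hv' : v ∈ Icc a T := uIcc_subset_Icc (hmem hx) (hmem hy) (uIoc_subset_uIcc hv)
    rw [Real.norm_of_nonneg (hc.le.trans (hlb v hv'))]
    exact hub v hv'
  have hlip := (Real.lipschitzOnWith_log_Ici hm).comp hNlip hNlb
  rw [← uIcc_of_le hab] at hlip
  have hac := hlip.absolutelyContinuousOnInterval
  have hderiv : ∀ᵐ x, x ∈ uIoc a b → deriv (Real.log ∘ N) x = -(g x / N x) := by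
    filter_upwards [hint.ae_hasDerivAt_integral] with x hx hxab
    rw [uIoc_of_le hab] at hxab
    have hxT : x ∈ Icc a b := Ioc_subset_Icc_self hxab
    have hd := (hx (by rw [uIcc_of_le haT]; exact hmem hxT) T right_mem_uIcc).neg
    have hd' : HasDerivAt N (-g x) x := by
      rwa [show N = -fun y => ∫ t in T..y, g t from
        funext fun y => intervalIntegral.integral_symm T y]
    have := (hd'.log (hm.trans_le (hNlb x hxT)).ne').deriv
    rw [← neg_div]
    exact this
  have hI : IntervalIntegrable (fun u => -(g u / N u)) volume a b :=
    hac.intervalIntegrable_deriv.congr_ae ((ae_restrict_iff' measurableSet_uIoc).2 hderiv)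
  refine ⟨by simpa [Pi.neg_def] using hI.neg, ?_⟩
  have h1 := hac.integral_deriv_eq_sub
  rw [intervalIntegral.integral_congr_ae hderiv, intervalIntegral.integral_neg] at h1
  simp only [Function.comp_apply, hN] at h1
  linarith

/-- Deterministic case of Lemma 4.2: if `A(u)·∫_u^T (2η)⁻¹ ≥ 1` a.e., then the discount
factor is bounded by `(∫_s^T η⁻¹)/(∫_r^T η⁻¹) ≤ (‖η‖/η⋆)(T-s)/(T-r)`. -/
theorem stmt_17 (T ηstar ηnorm : ℝ) (hT : 0 < T) (hηstar : 0 < ηstar) (hηnorm : ηstar ≤ ηnorm)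
    (η A : ℝ → ℝ) (hηm : Measurable η)
    (hηlb : ∀ u ∈ Icc (0:ℝ) T, ηstar ≤ η u) (hηub : ∀ u ∈ Icc (0:ℝ) T, η u ≤ ηnorm)
    (hA0 : ∀ u ∈ Ico (0:ℝ) T, 0 ≤ A u)
    (hAloc : LocallyIntegrableOn A (Ico (0:ℝ) T))
    (hAlb : ∀ᵐ u ∂(volume.restrict (Ico (0:ℝ) T)),
      1 ≤ A u * ∫ s in u..T, (2 * η s)⁻¹) :
    ∀ r s : ℝ, 0 ≤ r → r ≤ s → s < T →
      Real.exp (-∫ u in r..s, A u / (2 * η u)) ≤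
          (∫ v in s..T, (η v)⁻¹) / (∫ v in r..T, (η v)⁻¹) ∧
        (∫ v in s..T, (η v)⁻¹) / (∫ v in r..T, (η v)⁻¹) ≤
          ηnorm / ηstar * ((T - s) / (T - r)) := by
  intro r s hr hrs hsT
  have hrT : r < T := hrs.trans_lt hsT
  have hηnorm0 : 0 < ηnorm := hηstar.trans_le hηnorm
  have hIcc : ∀ x ∈ Icc r T, x ∈ Icc (0:ℝ) T := fun x hx => ⟨hr.trans hx.1, hx.2⟩
  have hpos : ∀ x ∈ Icc r T, 0 < η x := fun x hx => hηstar.trans_le (hηlb x (hIcc x hx))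
  have hub : ∀ x ∈ Icc r T, (η x)⁻¹ ≤ ηstar⁻¹ := fun x hx =>
    inv_anti₀ hηstar (hηlb x (hIcc x hx))
  have hlb : ∀ x ∈ Icc r T, ηnorm⁻¹ ≤ (η x)⁻¹ := fun x hx =>
    inv_anti₀ (hpos x hx) (hηub x (hIcc x hx))
  have hint : IntervalIntegrable (fun v => (η v)⁻¹) volume r T := by
    refine (intervalIntegrable_const (c := ηstar⁻¹)).mono_fun hηm.inv.aestronglyMeasurable ?_
    refine (ae_restrict_iff' measurableSet_uIoc).2 (.of_forall fun x hx => ?_)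
    rw [uIoc_of_le hrT.le] at hx
    have hx' := Ioc_subset_Icc_self hx
    beta_reduce
    rw [Real.norm_of_nonneg (inv_pos.2 (hpos x hx')).le, Real.norm_of_nonneg (inv_pos.2 hηstar).le]
    exact hub x hx'
  have hNlow : ∀ x, r ≤ x → x ≤ T → ηnorm⁻¹ * (T - x) ≤ ∫ v in x..T, (η v)⁻¹ := fun x h1 h2 =>
    mul_sub_le_intervalIntegral_of_le hint hlb h1 h2
  have hNpos : ∀ x, r ≤ x → x < T → 0 < ∫ v in x..T, (η v)⁻¹ := fun x h1 h2 =>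
    (mul_pos (inv_pos.2 hηnorm0) (sub_pos.2 h2)).trans_le (hNlow x h1 h2.le)
  have hNs := hNpos s hrs hsT
  have hNr := hNpos r le_rfl hrT
  constructor
  · obtain ⟨hI, hlog⟩ := integral_div_tail_integral_eq_log_sub_log (inv_pos.2 hηnorm0) hint hlb hub
      hrs hsT
    have hAI : IntervalIntegrable A volume r s := by
      rw [intervalIntegrable_iff_integrableOn_Icc_of_le hrs]
      exact hAloc.integrableOn_compact_subset (fun x hx => ⟨hr.trans hx.1, hx.2.trans_lt hsT⟩)
        isCompact_Icc
    have hAηI : IntervalIntegrable (fun u => A u / (2 * η u)) volume r s := by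
      rw [intervalIntegrable_iff] at hAI ⊢
      refine Integrable.mul_bdd (c := (2 * ηstar)⁻¹) hAI
        (hηm.const_mul 2).inv.aestronglyMeasurable ?_
      refine (ae_restrict_iff' measurableSet_uIoc).2 (.of_forall fun x hx => ?_)
      rw [uIoc_of_le hrs] at hx
      have hx' : x ∈ Icc r T := ⟨hx.1.le, hx.2.trans hsT.le⟩
      have := hpos x hx'
      rw [Real.norm_of_nonneg (by positivity)]
      exact inv_anti₀ (by positivity)
        (mul_le_mul_of_nonneg_left (hηlb x (hIcc x hx')) zero_le_two)
    have hmono : ∫ u in r..s, (η u)⁻¹ / ∫ v in u..T, (η v)⁻¹ ≤ ∫ u in r..s, A u / (2 * η u) := by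
      refine intervalIntegral.integral_mono_ae_restrict hrs hI hAηI ?_
      have hsub : Icc r s ⊆ Ico (0:ℝ) T := fun x hx => ⟨hr.trans hx.1, hx.2.trans_lt hsT⟩
      filter_upwards [ae_restrict_of_ae_restrict_of_subset hsub hAlb,
        ae_restrict_mem measurableSet_Icc] with u hu hur
      have huT : u < T := hur.2.trans_lt hsT
      have hη := hpos u ⟨hur.1, huT.le⟩
      have hN := hNpos u hur.1 huT
      simp only [mul_inv, intervalIntegral.integral_const_mul] at hu
      rw [div_le_div_iff₀ hN (by positivity)]
      have hη1 : (η u)⁻¹ * (2 * η u) = 2 := by field_simp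
      linarith
    rw [← Real.exp_log (div_pos hNs hNr), Real.log_div hNs.ne' hNr.ne']
    exact Real.exp_le_exp.2 (by linarith)
  · have hup : ∫ v in s..T, (η v)⁻¹ ≤ ηstar⁻¹ * (T - s) := by
      have h := mul_sub_le_intervalIntegral_of_le hint.neg
        (fun x hx => neg_le_neg (hub x hx)) hrs hsT.le
      simp only [Pi.neg_apply, intervalIntegral.integral_neg] at h
      linarith
    have hrT' : 0 < T - r := sub_pos.2 hrT
    calc (∫ v in s..T, (η v)⁻¹) / (∫ v in r..T, (η v)⁻¹)
        ≤ (ηstar⁻¹ * (T - s)) / (ηnorm⁻¹ * (T - r)) :=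
          div_le_div₀ (mul_nonneg (inv_pos.2 hηstar).le (sub_pos.2 hsT).le) hup
            (mul_pos (inv_pos.2 hηnorm0) hrT') (hNlow r le_rfl hrT.le)
      _ = ηnorm / ηstar * ((T - s) / (T - r)) := by field_simp
end

section
/- Let T>0 and let η,λ>0 be constants; set γ=√(λ/η). For each n∈ℕ let Aⁿ:[0,T]→ℝ be the unique continuously differentiable solution of the terminal value problem (Aⁿ)'(t)=Aⁿ(t)²/(2η)−2λ on [0,T] with Aⁿ(T)=2n. Then for every t∈[0,T) the sequence (Aⁿ(t))_n is nondecreasing in n and converges, as n→∞, to A(t)=2ηγ·cosh(γ(T−t))/sinh(γ(T−t)), the solution of the same Riccati equation with A(t)→+∞ as t→T⁻. -/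
open MeasureTheory Set Filter Real
open scoped Topology

/-- A solution of a homogeneous linear scalar ODE with continuous coefficient vanishing at the right
endpoint vanishes identically. -/
theorem eq_zero_of_hasDerivWithinAt_mul {a b : ℝ} {F g : ℝ → ℝ} (hg : ContinuousOn g (Icc a b))
    (hF : ∀ t ∈ Icc a b, HasDerivWithinAt F (g t * F t) (Icc a b) t) (hb : F b = 0) :
    ∀ t ∈ Icc a b, F t = 0 := by
  obtain ⟨C, hC⟩ := isCompact_Icc.exists_bound_of_continuousOn hg
  have hlip : ∀ t ∈ Ioc a b,
      LipschitzOnWith C.toNNReal (fun x : ℝ => g t * x) ((fun _ => univ : ℝ → Set ℝ) t) := by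
    intro t ht
    refine LipschitzOnWith.of_dist_le_mul fun x _ y _ => ?_
    rw [Real.dist_eq, Real.dist_eq, ← mul_sub, abs_mul]
    exact mul_le_mul_of_nonneg_right
      ((hC t (Ioc_subset_Icc_self ht)).trans (Real.le_coe_toNNReal C)) (abs_nonneg _)
  have hmem : ∀ t ∈ Ioc a b, Icc a b ∈ 𝓝[≤] t := fun t ht =>
    mem_of_superset (Icc_mem_nhdsLE ht.1) (Icc_subset_Icc_right ht.2)
  have h := ODE_solution_unique_of_mem_Icc_left (v := fun t x => g t * x) hlip
    (fun t ht => (hF t ht).continuousWithinAt)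
    (fun t ht => (hF t (Ioc_subset_Icc_self ht)).mono_of_mem_nhdsWithin (hmem t ht))
    (fun _ _ => mem_univ _) (g := fun _ => 0) continuousOn_const
    (fun t _ => by simpa using hasDerivWithinAt_const t (Iic t) (0 : ℝ))
    (fun _ _ => mem_univ _) hb
  exact h

/-- Cross-multiplied closed form of the solution of the Riccati equation
`A' = A² / (2η) - 2ηγ²` with terminal value `a` at `T`. -/
theorem riccati_mul_eq {T η γ a : ℝ} (hη : 0 < η) {A : ℝ → ℝ}
    (hA : ∀ t ∈ Icc (0 : ℝ) T,
      HasDerivWithinAt A (A t ^ 2 / (2 * η) - 2 * (η * γ ^ 2)) (Icc (0 : ℝ) T) t)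
    (hT : A T = a) :
    ∀ t ∈ Icc (0 : ℝ) T,
      A t * (2 * η * γ * cosh (γ * (T - t)) + a * sinh (γ * (T - t))) =
        2 * η * γ * (a * cosh (γ * (T - t)) + 2 * η * γ * sinh (γ * (T - t))) := by
  intro t ht
  refine sub_eq_zero.1 (eq_zero_of_hasDerivWithinAt_mul (g := fun t => A t / (2 * η))
    (F := fun t => A t * (2 * η * γ * cosh (γ * (T - t)) + a * sinh (γ * (T - t))) -
        2 * η * γ * (a * cosh (γ * (T - t)) + 2 * η * γ * sinh (γ * (T - t))))
    (ContinuousOn.div_const (fun t ht => (hA t ht).continuousWithinAt) _) ?_ ?_ t ht)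
  · intro t ht
    have hs : HasDerivAt (fun t => γ * (T - t)) (γ * (-1)) t :=
      ((hasDerivAt_id t).const_sub T).const_mul γ
    have hc := hs.cosh.hasDerivWithinAt (s := Icc (0 : ℝ) T)
    have hsh := hs.sinh.hasDerivWithinAt (s := Icc (0 : ℝ) T)
    refine (((hA t ht).mul ((hc.const_mul (2 * η * γ)).add (hsh.const_mul a))).sub
      (((hc.const_mul a).add (hsh.const_mul (2 * η * γ))).const_mul (2 * η * γ))).congr_deriv ?_
    simp only [Pi.add_apply]
    field_simp
    ring
  · simp [hT]
    ring

/-- The solution of the Riccati equation with terminal value `a ≥ 0` as the singular solution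
minus an explicit correction. -/
theorem riccati_eq_singular_sub {T η γ a : ℝ} (hη : 0 < η) (hγ : 0 < γ) (ha : 0 ≤ a) {A : ℝ → ℝ}
    (hA : ∀ t ∈ Icc (0 : ℝ) T,
      HasDerivWithinAt A (A t ^ 2 / (2 * η) - 2 * (η * γ ^ 2)) (Icc (0 : ℝ) T) t)
    (hT : A T = a) {t : ℝ} (ht : t ∈ Ico (0 : ℝ) T) :
    A t = 2 * η * γ * cosh (γ * (T - t)) / sinh (γ * (T - t)) -
      (2 * η * γ) ^ 2 / sinh (γ * (T - t)) /
        (2 * η * γ * cosh (γ * (T - t)) + a * sinh (γ * (T - t))) := by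
  have hs : 0 < sinh (γ * (T - t)) := sinh_pos_iff.2 (mul_pos hγ (sub_pos.2 ht.2))
  have hc : 0 < cosh (γ * (T - t)) := cosh_pos _
  have hD : 0 < 2 * η * γ * cosh (γ * (T - t)) + a * sinh (γ * (T - t)) := by positivity
  rw [eq_div_of_mul_eq hD.ne' (riccati_mul_eq hη hA hT t (Ico_subset_Icc_self ht)),
    div_div, div_sub_div _ _ hs.ne' (mul_pos hs hD).ne', div_eq_div_iff hD.ne' (by positivity)]
  have hcs := cosh_sq (γ * (T - t))
  generalize cosh (γ * (T - t)) = C at *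
  generalize sinh (γ * (T - t)) = S at *
  linear_combination (-(2 * η * γ) ^ 2 * S * (2 * η * γ * C + a * S)) * hcs

/-- The solutions `Aⁿ` of the Riccati equation with terminal value `2n` are nondecreasing in
`n` and converge pointwise on `[0,T)` to the singular solution `2ηγ·cosh(γ(T-t))/sinh(γ(T-t))`. -/
theorem stmt_19 (T η lam γ : ℝ) (hT : 0 < T) (hη : 0 < η) (hlam : 0 < lam)
    (hγ : γ = Real.sqrt (lam / η))
    (An : ℕ → ℝ → ℝ)
    (hode : ∀ n : ℕ, ∀ t ∈ Icc (0:ℝ) T,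
      HasDerivWithinAt (An n) ((An n t) ^ 2 / (2 * η) - 2 * lam) (Icc (0:ℝ) T) t)
    (hterm : ∀ n : ℕ, An n T = 2 * n) :
    ∀ t ∈ Ico (0:ℝ) T,
      (Monotone fun n => An n t) ∧
      Tendsto (fun n => An n t) atTop
        (𝓝 (2 * η * γ * Real.cosh (γ * (T - t)) / Real.sinh (γ * (T - t)))) := by
  intro t ht
  have hγ0 : 0 < γ := hγ ▸ Real.sqrt_pos.2 (div_pos hlam hη)
  have hl : lam = η * γ ^ 2 := by
    rw [hγ, Real.sq_sqrt (div_pos hlam hη).le]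
    field_simp
  subst hl
  have hs : 0 < sinh (γ * (T - t)) := sinh_pos_iff.2 (mul_pos hγ0 (sub_pos.2 ht.2))
  have hc : 0 < cosh (γ * (T - t)) := cosh_pos _
  have hform := fun n : ℕ =>
    riccati_eq_singular_sub hη hγ0 (by positivity) (hode n) (hterm n) ht
  simp only [hform]
  constructor
  · intro m n hmn
    dsimp only
    gcongr
  · have hD : Tendsto (fun n : ℕ => 2 * η * γ * cosh (γ * (T - t)) +
        2 * (n : ℝ) * sinh (γ * (T - t))) atTop atTop :=
      tendsto_atTop_add_const_left _ _
        ((tendsto_natCast_atTop_atTop.const_mul_atTop two_pos).atTop_mul_const hs)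
    simpa using tendsto_const_nhds.sub (hD.const_div_atTop _)
end
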